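/- Every L-formula φ(t₀) with exactly one free first-order variable and no free second-order variables has a trivial truth set in each model M_k: for every integer k ≥ 1, the set {t ∈ ℝ : M_k ⊨ φ[t]} is one of ∅, ℝ, P_k, or ℝ ∖ P_k. -/

import Mathlib

/-- Formulas of second-order monadic logic of order `L` over the signature `<`, `B`, `P`,
in de Bruijn style: `Fml m n` has first-order variables `Fin m` and monadic second-order
variables `Fin n`. -/
inductive Fml : ℕ → ℕ → Type
  | eq {m n : ℕ} (i j : Fin m) : Fml m n
  | lt {m n : ℕ} (i j : Fin m) : Fml m n
  | B {m n : ℕ} (i j : Fin m) : Fml m n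
  | P {m n : ℕ} (i : Fin m) : Fml m n
  | X {m n : ℕ} (x : Fin n) (i : Fin m) : Fml m n
  | not {m n : ℕ} (φ : Fml m n) : Fml m n
  | and {m n : ℕ} (φ ψ : Fml m n) : Fml m n
  | exFO {m n : ℕ} (φ : Fml (m + 1) n) : Fml m n
  | exSO {m n : ℕ} (φ : Fml m (n + 1)) : Fml m n

/-- Satisfaction of an `L`-formula in a structure with domain `D`, order `lo`,
binary relation `Bo` and unary predicate `Pred`, under assignments `v` (first-order)
and `w` (second-order). -/
def Fml.Sat {D : Type} (lo Bo : D → D → Prop) (Pred : Set D) :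
    ∀ {m n : ℕ}, Fml m n → (Fin m → D) → (Fin n → Set D) → Prop
  | _, _, .eq i j, v, _ => v i = v j
  | _, _, .lt i j, v, _ => lo (v i) (v j)
  | _, _, .B i j, v, _ => Bo (v i) (v j)
  | _, _, .P i, v, _ => v i ∈ Pred
  | _, _, .X x i, v, w => v i ∈ w x
  | _, _, .not φ, v, w => ¬ Fml.Sat lo Bo Pred φ v w
  | _, _, .and φ ψ, v, w => Fml.Sat lo Bo Pred φ v w ∧ Fml.Sat lo Bo Pred ψ v w
  | _, _, .exFO φ, v, w => ∃ d : D, Fml.Sat lo Bo Pred φ (Fin.cons d v) w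
  | _, _, .exSO φ, v, w => ∃ A : Set D, Fml.Sat lo Bo Pred φ v (Fin.cons A w)

/-- Quantifier depth (counting both first- and second-order quantifiers). -/
def Fml.qd : ∀ {m n : ℕ}, Fml m n → ℕ
  | _, _, .eq _ _ => 0
  | _, _, .lt _ _ => 0
  | _, _, .B _ _ => 0
  | _, _, .P _ => 0
  | _, _, .X _ _ => 0
  | _, _, .not φ => φ.qd
  | _, _, .and φ ψ => max φ.qd ψ.qd
  | _, _, .exFO φ => φ.qd + 1
  | _, _, .exSO φ => φ.qd + 1

/-- Satisfaction over the real line: `<` is the usual order and `B(t,s) ↔ s = t + 1`. -/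
def Fml.SatR (Pred : Set ℝ) {m n : ℕ} (φ : Fml m n)
    (v : Fin m → ℝ) (w : Fin n → Set ℝ) : Prop :=
  Fml.Sat (· < ·) (fun t s => s = t + 1) Pred φ v w

/-- The set `P_k = {m/k : m ∈ ℤ}`, the interpretation of `P` in the model `M_k`. -/
def Pk (k : ℕ) : Set ℝ := {x : ℝ | ∃ m : ℤ, x = m / k}

/-- Satisfaction is invariant under automorphisms of the structure. -/
theorem Fml.sat_equiv_iff {D : Type} {lo Bo : D → D → Prop} {Pred : Set D} (e : D ≃ D)
    (hlo : ∀ a b, lo (e a) (e b) ↔ lo a b) (hBo : ∀ a b, Bo (e a) (e b) ↔ Bo a b)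
    (hP : ∀ a, e a ∈ Pred ↔ a ∈ Pred) {m n : ℕ} (φ : Fml m n) (v : Fin m → D)
    (w : Fin n → Set D) :
    Fml.Sat lo Bo Pred φ (e ∘ v) (Set.image e ∘ w) ↔ Fml.Sat lo Bo Pred φ v w := by
  induction φ with
  | eq i j => simp [Fml.Sat]
  | lt i j => exact hlo _ _
  | B i j => exact hBo _ _
  | P i => exact hP _
  | X x i => simp [Fml.Sat]
  | not φ ih => exact not_congr (ih v w)
  | and φ ψ ih₁ ih₂ => exact and_congr (ih₁ v w) (ih₂ v w)
  | exFO φ ih =>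
    simp only [Fml.Sat]
    rw [e.surjective.exists]
    refine exists_congr fun d => ?_
    rw [← ih (Fin.cons d v), Fin.comp_cons]
  | exSO φ ih =>
    simp only [Fml.Sat]
    rw [e.surjective.image_surjective.exists]
    refine exists_congr fun A => ?_
    rw [← ih v (Fin.cons A w), Fin.comp_cons]

/-- The map of the line that fixes each integer and raises fractional parts to the power `p`. -/
noncomputable def fractPow (p x : ℝ) : ℝ := ⌊x⌋ + Int.fract x ^ p

theorem fract_rpow_mem_Ico {p : ℝ} (hp : 0 < p) (x : ℝ) : Int.fract x ^ p ∈ Set.Ico (0 : ℝ) 1 :=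
  ⟨Real.rpow_nonneg (Int.fract_nonneg x) p,
    Real.rpow_lt_one (Int.fract_nonneg x) (Int.fract_lt_one x) hp⟩

theorem floor_fractPow {p : ℝ} (hp : 0 < p) (x : ℝ) : ⌊fractPow p x⌋ = ⌊x⌋ := by
  have h := fract_rpow_mem_Ico hp x
  rw [fractPow, Int.floor_intCast_add, Int.floor_eq_zero_iff.2 h, add_zero]

theorem fract_fractPow {p : ℝ} (hp : 0 < p) (x : ℝ) :
    Int.fract (fractPow p x) = Int.fract x ^ p := by
  rw [Int.fract, floor_fractPow hp, fractPow, add_sub_cancel_left]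

theorem fractPow_inv_fractPow {p : ℝ} (hp : 0 < p) (x : ℝ) :
    fractPow p⁻¹ (fractPow p x) = x := by
  rw [fractPow, floor_fractPow hp, fract_fractPow hp,
    Real.rpow_rpow_inv (Int.fract_nonneg x) hp.ne', Int.floor_add_fract]

theorem strictMono_fractPow {p : ℝ} (hp : 0 < p) : StrictMono (fractPow p) := by
  intro x y hxy
  have hx := fract_rpow_mem_Ico hp x
  have hy := fract_rpow_mem_Ico hp y
  rcases (Int.floor_mono hxy.le).eq_or_lt with h | h
  · have : Int.fract x < Int.fract y := by
      rw [Int.fract, Int.fract, h]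
      linarith
    have := Real.rpow_lt_rpow (Int.fract_nonneg x) this hp
    rw [fractPow, fractPow, h]
    linarith
  · have : (⌊x⌋ : ℝ) + 1 ≤ ⌊y⌋ := by exact_mod_cast h
    rw [fractPow, fractPow]
    linarith [hx.2, hy.1]

theorem fractPow_add_intCast (p x : ℝ) (n : ℤ) : fractPow p (x + n) = fractPow p x + n := by
  rw [fractPow, fractPow, Int.floor_add_intCast, Int.fract_add_intCast]
  push_cast
  ring

/-- `fractPow p` as a permutation of the line. -/
noncomputable def fractPowEquiv (p : ℝ) (hp : 0 < p) : ℝ ≃ ℝ where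
  toFun := fractPow p
  invFun := fractPow p⁻¹
  left_inv := fractPow_inv_fractPow hp
  right_inv x := by simpa using fractPow_inv_fractPow (inv_pos.2 hp) x

theorem exists_fract_rpow_eq {x y : ℝ} (h : Int.fract x = 0 ↔ Int.fract y = 0) :
    ∃ p : ℝ, 0 < p ∧ Int.fract x ^ p = Int.fract y := by
  by_cases hx : Int.fract x = 0
  · exact ⟨1, one_pos, by rw [Real.rpow_one, hx, h.1 hx]⟩
  · have hx0 := (Int.fract_nonneg x).lt_of_ne' hx
    have hy0 := (Int.fract_nonneg y).lt_of_ne' (mt h.2 hx)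
    have hlx := Real.log_neg hx0 (Int.fract_lt_one x)
    refine ⟨Real.log (Int.fract y) / Real.log (Int.fract x),
      div_pos_of_neg_of_neg (Real.log_neg hy0 (Int.fract_lt_one y)) hlx, ?_⟩
    rw [Real.rpow_def_of_pos hx0, mul_div_cancel₀ _ hlx.ne, Real.exp_log hy0]

theorem mem_Pk_iff {k : ℕ} (hk : 1 ≤ k) (x : ℝ) : x ∈ Pk k ↔ Int.fract (k * x) = 0 := by
  have hk0 : (k : ℝ) ≠ 0 := by positivity
  rw [Int.fract_eq_zero_iff]
  refine exists_congr fun m => ?_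
  rw [eq_div_iff hk0, mul_comm, eq_comm]

/-- Any two points that are both in `P_k` or both outside it are related by an
automorphism of `M_k`. -/
theorem exists_automorphism_Mk {k : ℕ} (hk : 1 ≤ k) {s t : ℝ} (h : s ∈ Pk k ↔ t ∈ Pk k) :
    ∃ e : ℝ ≃ ℝ, StrictMono e ∧ (∀ x, e (x + 1) = e x + 1) ∧
      (∀ x, e x ∈ Pk k ↔ x ∈ Pk k) ∧ e s = t := by
  have hk0 : (k : ℝ) ≠ 0 := by positivity
  have hkpos : (0 : ℝ) < k := by positivity
  obtain ⟨p, hp, hst⟩ := exists_fract_rpow_eq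
    ((mem_Pk_iff hk s).symm.trans (h.trans (mem_Pk_iff hk t)))
  set c : ℤ := ⌊k * t⌋ - ⌊k * s⌋ with hc
  let e : ℝ ≃ ℝ := (Equiv.mulLeft₀ (k : ℝ) hk0).trans
    ((fractPowEquiv p hp).trans ((Equiv.addRight (c : ℝ)).trans (Equiv.mulLeft₀ (k : ℝ) hk0).symm))
  have he : ∀ x, k * e x = fractPow p (k * x) + c := fun x =>
    (Equiv.mulLeft₀ (k : ℝ) hk0).apply_symm_apply _
  refine ⟨e, fun x y hxy => ?_, fun x => ?_, fun x => ?_, ?_⟩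
  · refine lt_of_mul_lt_mul_left ?_ hkpos.le
    rw [he, he]
    gcongr
    exact strictMono_fractPow hp (by gcongr)
  · refine mul_left_cancel₀ hk0 ?_
    have := fractPow_add_intCast p (k * x) k
    push_cast at this
    rw [mul_add, mul_one, he, he, mul_add, mul_one, this]
    ring
  · rw [mem_Pk_iff hk, mem_Pk_iff hk, he, Int.fract_add_intCast, fract_fractPow hp,
      Real.rpow_eq_zero (Int.fract_nonneg _) hp.ne']
  · refine mul_left_cancel₀ hk0 ?_
    rw [he, fractPow, hst, hc]
    push_cast
    linarith [Int.floor_add_fract (k * t)]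

theorem satR_Pk_iff {k : ℕ} (hk : 1 ≤ k) (φ : Fml 1 0) {s t : ℝ} (h : s ∈ Pk k ↔ t ∈ Pk k) :
    Fml.SatR (Pk k) φ (fun _ => s) Fin.elim0 ↔ Fml.SatR (Pk k) φ (fun _ => t) Fin.elim0 := by
  obtain ⟨e, hmono, hadd, hP, rfl⟩ := exists_automorphism_Mk hk h
  have := Fml.sat_equiv_iff (lo := (· < ·)) (Bo := fun t s : ℝ => s = t + 1) e
    (fun _ _ => hmono.lt_iff_lt) (fun a b => by rw [← hadd, e.apply_eq_iff_eq]) hP φ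
    (fun _ => s) Fin.elim0
  rw [Subsingleton.elim (Set.image e ∘ Fin.elim0) Fin.elim0] at this
  exact this.symm

/-- A set that is a union of blocks of the partition `{P, Pᶜ}` is trivial. -/
theorem eq_trivial_of_invariant {α : Type*} {P S : Set α}
    (h : ∀ s t, (s ∈ P ↔ t ∈ P) → (s ∈ S ↔ t ∈ S)) :
    S = ∅ ∨ S = Set.univ ∨ S = P ∨ S = Set.univ \ P := by
  simp only [Set.ext_iff, Set.mem_empty_iff_false, Set.mem_univ, Set.mem_sdiff]
  by_cases h₁ : ∃ a ∈ P, a ∈ S <;> by_cases h₂ : ∃ b ∉ P, b ∈ S <;> grind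

/-- Every `L`-formula with one free first-order variable and no free second-order
variables has a trivial truth set in each model `M_k`. -/
theorem truth_sets_in_Mk_trivial (k : ℕ) (hk : 1 ≤ k) (φ : Fml 1 0) :
    {t : ℝ | Fml.SatR (Pk k) φ (fun _ => t) Fin.elim0} = ∅ ∨
    {t : ℝ | Fml.SatR (Pk k) φ (fun _ => t) Fin.elim0} = Set.univ ∨
    {t : ℝ | Fml.SatR (Pk k) φ (fun _ => t) Fin.elim0} = Pk k ∨
    {t : ℝ | Fml.SatR (Pk k) φ (fun _ => t) Fin.elim0} = Set.univ \ Pk k := by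
  exact eq_trivial_of_invariant fun _ _ h => satR_Pk_iff hk φ h
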